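/- Let f(u,v) = (uv/2 + v, u − v²/2), φ(u,v) = 4 + 2u + (9/4)v², Λ±(u,v) = −v/4 ± √(φ(u,v))/2, and r₊(u,v) = (3v/4 + √(φ(u,v))/2, 1), r₋(u,v) = (3v/4 − √(φ(u,v))/2, 1). Then for every (u,v) with φ(u,v) > 0, the directional derivatives of the eigenvalues along their eigenvector fields satisfy (r± · ∇Λ±)(u,v) = ± 3v / (2√(φ(u,v))). In particular, on any region where φ > 0 and v ≠ 0, both characteristic fields of the system are genuinely nonlinear, i.e., ∇Λ⁺ · r₊ ≠ 0 and ∇Λ⁻ · r₋ ≠ 0. -/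

import Mathlib

noncomputable section

/-- The flux of the example system: `f(u,v) = (uv/2 + v, u - v²/2)`. -/
def exFlux (w : Fin 2 → ℝ) : Fin 2 → ℝ :=
  ![w 0 * w 1 / 2 + w 1, w 0 - w 1 ^ 2 / 2]

/-- `φ(u,v) = 4 + 2u + (9/4)v²`. -/
def exPhi (w : Fin 2 → ℝ) : ℝ := 4 + 2 * w 0 + (9 / 4) * w 1 ^ 2

/-- `Λ⁺(u,v) = -v/4 + √φ/2`. -/
def exLp (w : Fin 2 → ℝ) : ℝ := -(w 1) / 4 + Real.sqrt (exPhi w) / 2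

/-- `Λ⁻(u,v) = -v/4 - √φ/2`. -/
def exLm (w : Fin 2 → ℝ) : ℝ := -(w 1) / 4 - Real.sqrt (exPhi w) / 2

/-- `r₊(u,v) = (3v/4 + √φ/2, 1)`. -/
def exRp (w : Fin 2 → ℝ) : Fin 2 → ℝ := ![3 * w 1 / 4 + Real.sqrt (exPhi w) / 2, 1]

/-- `r₋(u,v) = (3v/4 - √φ/2, 1)`. -/
def exRm (w : Fin 2 → ℝ) : Fin 2 → ℝ := ![3 * w 1 / 4 - Real.sqrt (exPhi w) / 2, 1]

theorem exPhi_hasFDerivAt (p : Fin 2 → ℝ) :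
    HasFDerivAt exPhi ((2 : ℝ) • (ContinuousLinearMap.proj 0 : (Fin 2 → ℝ) →L[ℝ] ℝ) +
      (9 / 2 * p 1) • (ContinuousLinearMap.proj 1 : (Fin 2 → ℝ) →L[ℝ] ℝ)) p := by
  have h0 : HasFDerivAt (fun w : Fin 2 → ℝ => w 0)
    (ContinuousLinearMap.proj 0 : (Fin 2 → ℝ) →L[ℝ] ℝ) p := hasFDerivAt_apply 0 p
  have h1 : HasFDerivAt (fun w : Fin 2 → ℝ => w 1)
    (ContinuousLinearMap.proj 1 : (Fin 2 → ℝ) →L[ℝ] ℝ) p := hasFDerivAt_apply 1 p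
  have h := ((h0.const_mul 2).const_add 4).add ((h1.pow 2).const_mul (9 / 4))
  refine h.congr_fderiv ?_
  ext w
  simp
  ring

theorem exL_hasFDerivAt (p : Fin 2 → ℝ) (hp : 0 < exPhi p) (c : ℝ) (w : Fin 2 → ℝ) :
    fderiv ℝ (fun w => -(w 1) / 4 + c * Real.sqrt (exPhi w)) p w =
      -(w 1) / 4 + c * ((2 * w 0 + 9 / 2 * p 1 * w 1) / (2 * Real.sqrt (exPhi p))) := by
  have h1 : HasFDerivAt (fun w : Fin 2 → ℝ => w 1)
    (ContinuousLinearMap.proj 1 : (Fin 2 → ℝ) →L[ℝ] ℝ) p := hasFDerivAt_apply 1 p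
  have h := (h1.const_mul (-1 / 4)).add (((exPhi_hasFDerivAt p).sqrt hp.ne').const_mul c)
  have e : (fun w : Fin 2 → ℝ => -(w 1) / 4 + c * Real.sqrt (exPhi w)) =
      (fun w => (-1 / 4) * w 1) + fun w => c * Real.sqrt (exPhi w) := by
    funext w
    simp only [Pi.add_apply]
    ring
  rw [e, h.fderiv]
  simp
  ring

/-- on `{φ > 0}` the directional derivatives of the eigenvalues along the
corresponding eigenvector fields are `(r± · ∇Λ±)(u,v) = ± 3v / (2√φ)`; in particular,
where moreover `v ≠ 0`, both characteristic fields are genuinely nonlinear. -/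
theorem example_system_genuine_nonlinearity :
    ∀ p : Fin 2 → ℝ, 0 < exPhi p →
      (fderiv ℝ exLp p (exRp p) = 3 * p 1 / (2 * Real.sqrt (exPhi p)) ∧
       fderiv ℝ exLm p (exRm p) = -(3 * p 1) / (2 * Real.sqrt (exPhi p))) ∧
      (p 1 ≠ 0 →
        fderiv ℝ exLp p (exRp p) ≠ 0 ∧ fderiv ℝ exLm p (exRm p) ≠ 0) := by
  intro p hp
  have hs : 0 < Real.sqrt (exPhi p) := Real.sqrt_pos.mpr hp
  have ep : exLp = fun w => -(w 1) / 4 + (1 / 2) * Real.sqrt (exPhi w) := by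
    funext w
    unfold exLp
    ring
  have em : exLm = fun w => -(w 1) / 4 + (-1 / 2) * Real.sqrt (exPhi w) := by
    funext w
    unfold exLm
    ring
  have h1 : fderiv ℝ exLp p (exRp p) = 3 * p 1 / (2 * Real.sqrt (exPhi p)) := by
    rw [ep, exL_hasFDerivAt p hp]
    simp only [exRp, Matrix.cons_val_zero, Matrix.cons_val_one]
    field_simp
    ring
  have h2 : fderiv ℝ exLm p (exRm p) = -(3 * p 1) / (2 * Real.sqrt (exPhi p)) := by
    rw [em, exL_hasFDerivAt p hp]
    simp only [exRm, Matrix.cons_val_zero, Matrix.cons_val_one]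
    field_simp
    ring
  refine ⟨⟨h1, h2⟩, fun hv => ?_⟩
  rw [h1, h2]
  have h3 : 3 * p 1 ≠ 0 := mul_ne_zero (by norm_num) hv
  have h4 : 2 * Real.sqrt (exPhi p) ≠ 0 := by positivity
  exact ⟨div_ne_zero h3 h4, div_ne_zero (neg_ne_zero.mpr h3) h4⟩
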